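/- Fix τ ∈ ℂ with Im τ > 0 and μ, ξ ∈ ℂ with μ ∉ ℤ + τℤ and ξ ∉ ℤ + τℤ. For a function f : ℂ → ℂ define, at every point z ∉ ℤ + τℤ, the operators (R f)(z) := σ_μ(z|τ) f(z) − σ_ξ(z|τ) f(−z) and (R̄ f)(z) := σ_μ(−z|τ) f(z) − σ_{−ξ}(−z|τ) f(−z). Then the unitarity relation holds: for every f : ℂ → ℂ and every z ∉ ℤ + τℤ, (R(R̄ f))(z) = (℘⁰(μ|τ) − ℘⁰(ξ|τ)) f(z), where ℘⁰(w|τ) := (ϑ4(w|τ) ϑ1′(0|τ) / (ϑ1(w|τ) ϑ4(0|τ)))². In particular this constant vanishes when ξ = ±μ. -/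

import Mathlib

open Complex

/-- The Jacobi theta function
`ϑ₁(z|τ) = −i Σ_{n∈ℤ} (−1)^n exp(πiτ(n+1/2)² + (2n+1)πiz)`. -/
noncomputable def jacobiTheta1 (z τ : ℂ) : ℂ :=
  -I * ∑' n : ℤ, (-1 : ℂ) ^ n *
    Complex.exp ((Real.pi : ℂ) * I * τ * ((n : ℂ) + 1 / 2) ^ 2 +
      (2 * (n : ℂ) + 1) * (Real.pi : ℂ) * I * z)

/-- The Jacobi theta function `ϑ₄(z|τ) = Σ_{n∈ℤ} (−1)^n exp(πiτn² + 2πinz)`. -/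
noncomputable def jacobiTheta4 (z τ : ℂ) : ℂ :=
  ∑' n : ℤ, (-1 : ℂ) ^ n *
    Complex.exp ((Real.pi : ℂ) * I * τ * (n : ℂ) ^ 2 + 2 * (Real.pi : ℂ) * I * (n : ℂ) * z)

/-- The lattice `ℤ + τℤ ⊂ ℂ`. -/
def latticeZtau (τ : ℂ) : Set ℂ := {u | ∃ m n : ℤ, u = (m : ℂ) + (n : ℂ) * τ}

/-- `ϑ₁′(0|τ)`, the derivative of `z ↦ ϑ₁(z|τ)` at `z = 0`. -/
noncomputable def jacobiTheta1'zero (τ : ℂ) : ℂ := deriv (fun z => jacobiTheta1 z τ) 0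

/-- `σ_w(z|τ) = ϑ₁(z−w|τ) ϑ₁′(0|τ) / (ϑ₁(z|τ) ϑ₁(−w|τ))`. -/
noncomputable def sigmaTheta (w z τ : ℂ) : ℂ :=
  jacobiTheta1 (z - w) τ * jacobiTheta1'zero τ / (jacobiTheta1 z τ * jacobiTheta1 (-w) τ)

/-- `℘⁰(w|τ) = (ϑ₄(w|τ) ϑ₁′(0|τ) / (ϑ₁(w|τ) ϑ₄(0|τ)))²`. -/
noncomputable def wpZero (w τ : ℂ) : ℂ :=
  (jacobiTheta4 w τ * jacobiTheta1'zero τ / (jacobiTheta1 w τ * jacobiTheta4 0 τ)) ^ 2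

/-- The operator `(R f)(z) = σ_μ(z|τ) f(z) − σ_ξ(z|τ) f(−z)`. -/
noncomputable def opR (μ ξ τ : ℂ) (f : ℂ → ℂ) : ℂ → ℂ :=
  fun z => sigmaTheta μ z τ * f z - sigmaTheta ξ z τ * f (-z)

/-- The operator `(R̄ f)(z) = σ_μ(−z|τ) f(z) − σ_{−ξ}(−z|τ) f(−z)`. -/
noncomputable def opRbar (μ ξ τ : ℂ) (f : ℂ → ℂ) : ℂ → ℂ :=
  fun z => sigmaTheta μ (-z) τ * f z - sigmaTheta (-ξ) (-z) τ * f (-z)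

/-- Auxiliary second theta function, in terms of Mathlib's theta. -/
noncomputable def thB (z T : ℂ) : ℂ :=
  Complex.exp (Real.pi * I * T / 4 + Real.pi * I * z) * jacobiTheta₂ (z + T / 2) T

def parityMap : (ℤ × ℤ) ⊕ (ℤ × ℤ) → ℤ × ℤ :=
  Sum.elim (fun p => (p.1 + p.2, p.1 - p.2)) (fun p => (p.1 + p.2 + 1, p.1 - p.2))

lemma parityMap_bij : Function.Bijective parityMap := by
  constructor
  · rintro (⟨a, b⟩ | ⟨a, b⟩) (⟨c, d⟩ | ⟨c, d⟩) h <;>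
      simp only [parityMap, Sum.elim_inl, Sum.elim_inr, Prod.mk.injEq] at h
    · have h1 : a = c := by omega
      have h2 : b = d := by omega
      rw [h1, h2]
    · omega
    · omega
    · have h1 : a = c := by omega
      have h2 : b = d := by omega
      rw [h1, h2]
  · rintro ⟨m, n⟩
    rcases Int.even_or_odd' (m + n) with ⟨k, hk | hk⟩
    · refine ⟨Sum.inl (k, k - n), ?_⟩
      simp only [parityMap, Sum.elim_inl, Prod.mk.injEq]
      constructor <;> omega
    · refine ⟨Sum.inr (k, k - n), ?_⟩
      simp only [parityMap, Sum.elim_inr, Prod.mk.injEq]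
      constructor <;> omega

lemma hasSum_mul_int {f g : ℤ → ℂ} {a b : ℂ} (h1 : HasSum f a) (h2 : HasSum g b) :
    HasSum (fun p : ℤ × ℤ => f p.1 * g p.2) (a * b) := by
  have n1 : Summable (fun n => ‖f n‖) := h1.summable.norm
  have n2 : Summable (fun n => ‖g n‖) := h2.summable.norm
  have h3 : Summable (fun p : ℤ × ℤ => f p.1 * g p.2) := summable_mul_of_summable_norm n1 n2
  have h4 := tsum_mul_tsum_of_summable_norm n1 n2
  rw [h1.tsum_eq, h2.tsum_eq] at h4
  rw [h4]
  exact h3.hasSum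

lemma theta_mul (x y τ : ℂ) (hτ : 0 < τ.im) :
    jacobiTheta₂ x τ * jacobiTheta₂ y τ =
      jacobiTheta₂ (x + y) (2 * τ) * jacobiTheta₂ (x - y) (2 * τ) +
        thB (x + y) (2 * τ) * thB (x - y) (2 * τ) := by
  have h2 : 0 < (2 * τ).im := by simp [hτ]
  have T2 : ∀ u v : ℂ, HasSum (fun p : ℤ × ℤ => jacobiTheta₂_term p.1 u (2 * τ) *
      jacobiTheta₂_term p.2 v (2 * τ)) (jacobiTheta₂ u (2 * τ) * jacobiTheta₂ v (2 * τ)) :=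
    fun u v => hasSum_mul_int (f := fun n => jacobiTheta₂_term n u (2 * τ))
      (g := fun n => jacobiTheta₂_term n v (2 * τ))
      (hasSum_jacobiTheta₂_term u h2) (hasSum_jacobiTheta₂_term v h2)
  have H := hasSum_mul_int (f := fun n => jacobiTheta₂_term n x τ)
    (g := fun n => jacobiTheta₂_term n y τ)
    (hasSum_jacobiTheta₂_term x hτ) (hasSum_jacobiTheta₂_term y hτ)
  have H' := (Equiv.ofBijective _ parityMap_bij).hasSum_iff.mpr H
  refine H'.unique (HasSum.sum ?_ ?_)
  · convert! T2 (x + y) (x - y) using 1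
    ext ⟨a, b⟩
    simp only [Function.comp, Equiv.ofBijective_apply, parityMap, Sum.elim_inl,
      jacobiTheta₂_term, ← Complex.exp_add]
    congr 1
    push_cast
    ring
  · convert! (T2 (x + y + 2 * τ / 2) (x - y + 2 * τ / 2)).mul_left
      (Complex.exp (Real.pi * I * (2 * τ) / 4 + Real.pi * I * (x + y)) *
        Complex.exp (Real.pi * I * (2 * τ) / 4 + Real.pi * I * (x - y))) using 1
    · ext ⟨a, b⟩
      simp only [Function.comp, Equiv.ofBijective_apply, parityMap, Sum.elim_inr,
        jacobiTheta₂_term, ← Complex.exp_add]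
      congr 1
      push_cast
      ring
    · simp only [thB]
      ring

lemma exp_pi_neg : Complex.exp (-(Real.pi * I)) = -1 := by
  rw [Complex.exp_neg, Complex.exp_pi_mul_I]; norm_num

lemma thB_add_one (z T : ℂ) : thB (z + 1) T = -thB z T := by
  unfold thB
  rw [show z + 1 + T / 2 = z + T / 2 + 1 by ring, jacobiTheta₂_add_left,
    show Real.pi * I * T / 4 + Real.pi * I * (z + 1) =
      Real.pi * I * T / 4 + Real.pi * I * z + Real.pi * I by ring, Complex.exp_add _ (Real.pi * I),
    Complex.exp_pi_mul_I]
  ring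

lemma thA_half (z T : ℂ) : jacobiTheta₂ (z + T / 2) T =
    Complex.exp (-(Real.pi * I * T / 4 + Real.pi * I * z)) * thB z T := by
  unfold thB
  rw [← mul_assoc, ← Complex.exp_add, neg_add_cancel, Complex.exp_zero, one_mul]

lemma thB_half (z T : ℂ) : thB (z + T / 2) T =
    Complex.exp (-(Real.pi * I * T / 4 + Real.pi * I * z)) * jacobiTheta₂ z T := by
  unfold thB
  rw [show z + T / 2 + T / 2 = z + T by ring, jacobiTheta₂_add_left', ← mul_assoc,
    ← Complex.exp_add]
  congr 2
  ring

lemma thB_neg (z T : ℂ) : thB (-z) T = thB z T := by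
  have h := jacobiTheta₂_add_left' (z - T / 2) T
  unfold thB
  rw [show z + T / 2 = z - T / 2 + T by ring, h, ← jacobiTheta₂_neg_left (-z + T / 2),
    show -(-z + T / 2) = z - T / 2 by ring, ← mul_assoc, ← Complex.exp_add]
  congr 2
  ring

lemma neg_one_zpow_exp (n : ℤ) : (-1 : ℂ) ^ n = Complex.exp (n * (Real.pi * I)) := by
  rw [Complex.exp_int_mul, Complex.exp_pi_mul_I]

lemma theta4_eq (z τ : ℂ) : jacobiTheta4 z τ = jacobiTheta₂ (z + 1 / 2) τ := by
  unfold jacobiTheta4 jacobiTheta₂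
  refine tsum_congr fun n => ?_
  rw [neg_one_zpow_exp, ← Complex.exp_add, jacobiTheta₂_term]
  congr 1
  ring

lemma theta1_eq (z τ : ℂ) : jacobiTheta1 z τ =
    -I * (Complex.exp (Real.pi * I * τ / 4 + Real.pi * I * z) * jacobiTheta₂ (z + τ / 2 + 1 / 2) τ) := by
  unfold jacobiTheta1 jacobiTheta₂
  congr 1
  rw [← tsum_mul_left]
  refine tsum_congr fun n => ?_
  rw [neg_one_zpow_exp, ← Complex.exp_add, jacobiTheta₂_term, ← Complex.exp_add]
  congr 1
  ring

lemma theta1_eq_thB (z τ : ℂ) : jacobiTheta1 z τ = - thB (z + 1 / 2) τ := by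
  rw [theta1_eq]
  unfold thB
  rw [show Real.pi * I * τ / 4 + Real.pi * I * (z + 1 / 2) =
      Real.pi * I * τ / 4 + Real.pi * I * z + Real.pi / 2 * I by ring,
    Complex.exp_add _ (Real.pi / 2 * I), Complex.exp_pi_div_two_mul_I,
    show z + 1 / 2 + τ / 2 = z + τ / 2 + 1 / 2 by ring]
  ring

lemma theta1_neg (z τ : ℂ) : jacobiTheta1 (-z) τ = -jacobiTheta1 z τ := by
  rw [theta1_eq_thB, theta1_eq_thB, ← thB_neg (-z + 1 / 2),
    show z + 1 / 2 = -(-z + 1 / 2) + 1 by ring, thB_add_one]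
  ring

lemma theta4_neg (z τ : ℂ) : jacobiTheta4 (-z) τ = jacobiTheta4 z τ := by
  rw [theta4_eq, theta4_eq, ← jacobiTheta₂_neg_left (-z + 1 / 2),
    show z + 1 / 2 = -(-z + 1 / 2) + 1 by ring, jacobiTheta₂_add_left]

lemma theta4_mul (x y τ : ℂ) (hτ : 0 < τ.im) :
    jacobiTheta4 x τ * jacobiTheta4 y τ =
      jacobiTheta₂ (x + y) (2 * τ) * jacobiTheta₂ (x - y) (2 * τ) -
        thB (x + y) (2 * τ) * thB (x - y) (2 * τ) := by
  rw [theta4_eq, theta4_eq, theta_mul _ _ _ hτ, show x + 1 / 2 + (y + 1 / 2) = x + y + 1 by ring,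
    show x + 1 / 2 - (y + 1 / 2) = x - y by ring, jacobiTheta₂_add_left, thB_add_one]
  ring

lemma theta1_mul (x y τ : ℂ) (hτ : 0 < τ.im) :
    jacobiTheta1 x τ * jacobiTheta1 y τ =
      jacobiTheta₂ (x + y) (2 * τ) * thB (x - y) (2 * τ) -
        thB (x + y) (2 * τ) * jacobiTheta₂ (x - y) (2 * τ) := by
  have h := theta_mul (x + τ / 2 + 1 / 2) (y + τ / 2 + 1 / 2) τ hτ
  rw [show x + τ / 2 + 1 / 2 + (y + τ / 2 + 1 / 2) = x + y + (2 * τ) / 2 + 1 by ring,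
    show x + τ / 2 + 1 / 2 - (y + τ / 2 + 1 / 2) = x - y by ring, jacobiTheta₂_add_left,
    thB_add_one, thA_half, thB_half] at h
  rw [theta1_eq, theta1_eq]
  have e : Complex.exp (Real.pi * I * τ / 4 + Real.pi * I * x) *
      Complex.exp (Real.pi * I * τ / 4 + Real.pi * I * y) *
      Complex.exp (-(Real.pi * I * (2 * τ) / 4 + Real.pi * I * (x + y))) = 1 := by
    rw [← Complex.exp_add, ← Complex.exp_add, ← Complex.exp_zero]
    congr 1
    ring
  linear_combination (I ^ 2 * Complex.exp (Real.pi * I * τ / 4 + Real.pi * I * x) *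
      Complex.exp (Real.pi * I * τ / 4 + Real.pi * I * y)) * h +
      I ^ 2 * (thB (x + y) (2 * τ) * jacobiTheta₂ (x - y) (2 * τ) -
        jacobiTheta₂ (x + y) (2 * τ) * thB (x - y) (2 * τ)) * e +
      (thB (x + y) (2 * τ) * jacobiTheta₂ (x - y) (2 * τ) -
        jacobiTheta₂ (x + y) (2 * τ) * thB (x - y) (2 * τ)) * I_sq

lemma theta_addition (z m τ : ℂ) (hτ : 0 < τ.im) :
    jacobiTheta1 (z - m) τ * jacobiTheta1 (z + m) τ * jacobiTheta4 0 τ ^ 2 =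
      jacobiTheta1 z τ ^ 2 * jacobiTheta4 m τ ^ 2 -
        jacobiTheta4 z τ ^ 2 * jacobiTheta1 m τ ^ 2 := by
  have a := theta1_mul (z + m) (z - m) τ hτ
  have b := theta4_mul 0 0 τ hτ
  have c := theta1_mul z z τ hτ
  have d := theta1_mul m m τ hτ
  have e := theta4_mul z z τ hτ
  have f := theta4_mul m m τ hτ
  rw [show z + m + (z - m) = z + z by ring, show z + m - (z - m) = m + m by ring] at a
  simp only [sub_self, add_zero] at b c d e f
  simp only [pow_two]
  rw [mul_comm (jacobiTheta1 (z - m) τ), a, b, c, d, e, f]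
  ring

lemma theta_dup (x τ : ℂ) (hτ : 0 < τ.im) :
    jacobiTheta₂ x τ * jacobiTheta₂ (x + 1 / 2) τ =
      jacobiTheta₂ (2 * x + 1 / 2) (2 * τ) * jacobiTheta₂ (1 / 2) (2 * τ) := by
  have hB : thB (-(1 / 2)) (2 * τ) = 0 := by
    have h1 := thB_add_one (-(1 / 2)) (2 * τ)
    rw [show -(1 / 2 : ℂ) + 1 = 1 / 2 by ring] at h1
    have h2 := thB_neg (1 / 2) (2 * τ)
    linear_combination (1 / 2) * h2 + (1 / 2) * h1
  rw [theta_mul _ _ _ hτ, show x - (x + 1 / 2) = -(1 / 2) by ring, hB, jacobiTheta₂_neg_left,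
    show x + (x + 1 / 2) = 2 * x + 1 / 2 by ring]
  ring

lemma theta_ne_zero_of_large {T z : ℂ} {t : ℝ} (hT : 0 < T.im) (ht : |t| < 1 / 2)
    (hz : z.im = t * T.im) (hr : Real.exp (-(Real.pi * T.im * (1 - 2 * |t|))) < 1 / 3) :
    jacobiTheta₂ z T ≠ 0 := by
  intro h0
  set r := Real.exp (-(Real.pi * T.im * (1 - 2 * |t|))) with hrdef
  have hr0 : 0 < r := Real.exp_pos _
  have hb : ∀ n : ℤ, ∀ k : ℕ, |n| = (k : ℤ) + 1 → ‖jacobiTheta₂_term n z T‖ ≤ r ^ (k + 1) := by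
    intro n k hk
    rw [norm_jacobiTheta₂_term, hrdef, ← Real.exp_nat_mul]
    apply Real.exp_le_exp.mpr
    rw [hz]
    have hk' : |(n : ℝ)| = (k : ℝ) + 1 := by exact_mod_cast hk
    have h1 : (n : ℝ) ^ 2 = ((k : ℝ) + 1) ^ 2 := by rw [← sq_abs, hk']
    have h2 : -((n : ℝ) * t) ≤ (k + 1) * |t| := by
      rw [← hk', ← abs_mul]; exact neg_le_abs _
    have h3 : 0 < Real.pi * T.im := mul_pos Real.pi_pos hT
    have hk0 : (0 : ℝ) ≤ k := Nat.cast_nonneg k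
    rw [h1]
    push_cast
    have h4 := mul_le_mul_of_nonneg_left h2 h3.le
    have h5 : 0 ≤ Real.pi * T.im * (((k : ℝ) + 1) * k) := by positivity
    nlinarith
  have hs := (hasSum_jacobiTheta₂_term z hT).nat_add_neg
  rw [← hasSum_nat_add_iff' 1] at hs
  have hf0 : jacobiTheta₂_term 0 z T = 1 := by simp [jacobiTheta₂_term]
  simp only [h0, Finset.sum_range_one, Nat.cast_zero, neg_zero, hf0] at hs
  have hg : HasSum (fun n : ℕ => 2 * r * r ^ n) (2 * r * (1 - r)⁻¹) :=
    (hasSum_geometric_of_lt_one hr0.le (by linarith)).mul_left _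
  have hle := tsum_of_norm_bounded hg (f := fun n : ℕ => jacobiTheta₂_term ((n + 1 : ℕ) : ℤ) z T +
    jacobiTheta₂_term (-((n + 1 : ℕ) : ℤ)) z T) (by
      intro n
      refine (norm_add_le _ _).trans ?_
      have e1 := hb ((n + 1 : ℕ) : ℤ) n (by push_cast; exact abs_of_nonneg (by positivity))
      have e2 := hb (-((n + 1 : ℕ) : ℤ)) n (by
        rw [abs_neg]; push_cast; exact abs_of_nonneg (by positivity))
      calc _ ≤ r ^ (n + 1) + r ^ (n + 1) := add_le_add e1 e2
        _ = _ := by ring)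
  rw [hs.tsum_eq] at hle
  have : ‖(0 + 1 - (1 + 1) : ℂ)‖ = 1 := by norm_num
  rw [this, ← div_eq_mul_inv, le_div_iff₀ (by linarith)] at hle
  linarith

lemma exists_large {c : ℝ} (hc : 0 < c) :
    ∃ n : ℕ, Real.exp (-(Real.pi * ((2 : ℝ) ^ n * c))) < 1 / 3 := by
  have h1 : Filter.Tendsto (fun n : ℕ => Real.pi * ((2 : ℝ) ^ n * c)) Filter.atTop Filter.atTop :=
    ((tendsto_pow_atTop_atTop_of_one_lt (by norm_num)).atTop_mul_const hc).const_mul_atTop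
      Real.pi_pos
  have h2 := Real.tendsto_exp_neg_atTop_nhds_zero.comp h1
  exact (h2.eventually_lt_const (by norm_num : (0 : ℝ) < 1 / 3)).exists

lemma theta_half_ne_zero (τ : ℂ) (hτ : 0 < τ.im) : jacobiTheta₂ (1 / 2) τ ≠ 0 := by
  intro h0
  have key : ∀ n : ℕ, jacobiTheta₂ (1 / 2) ((2 : ℂ) ^ n * τ) = 0 := by
    intro n
    induction n with
    | zero => simpa using h0
    | succ n ih =>
      have him : 0 < ((2 : ℂ) ^ n * τ).im := by
        rw [show ((2 : ℂ) ^ n) = (((2 : ℝ) ^ n : ℝ) : ℂ) by push_cast; rfl, Complex.im_ofReal_mul]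
        positivity
      have h := theta_dup 0 _ him
      rw [zero_add, ih, mul_zero, mul_zero, zero_add] at h
      have h' := mul_self_eq_zero.mp h.symm
      rw [pow_succ, mul_comm _ (2 : ℂ), mul_assoc]
      exact h'
  obtain ⟨n, hn⟩ := exists_large hτ
  have him : ((2 : ℂ) ^ n * τ).im = 2 ^ n * τ.im := by
    rw [show ((2 : ℂ) ^ n) = (((2 : ℝ) ^ n : ℝ) : ℂ) by push_cast; rfl, Complex.im_ofReal_mul]
  refine theta_ne_zero_of_large (t := 0) (by rw [him]; positivity) (by norm_num) (by simp) ?_ (key n)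
  rw [him]
  simpa using hn

lemma theta_ne_zero_strip (τ z : ℂ) (hτ : 0 < τ.im) (t : ℝ) (ht : |t| < 1 / 2)
    (hz : z.im = t * τ.im) : jacobiTheta₂ z τ ≠ 0 := by
  intro h0
  have him : ∀ n : ℕ, ((2 : ℂ) ^ n * τ).im = 2 ^ n * τ.im := by
    intro n
    rw [show ((2 : ℂ) ^ n) = (((2 : ℝ) ^ n : ℝ) : ℂ) by push_cast; rfl, Complex.im_ofReal_mul]
  have key : ∀ n : ℕ, ∃ w : ℂ, w.im = t * ((2 : ℂ) ^ n * τ).im ∧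
      jacobiTheta₂ w ((2 : ℂ) ^ n * τ) = 0 := by
    intro n
    induction n with
    | zero => exact ⟨z, by simpa using hz, by simpa using h0⟩
    | succ n ih =>
      obtain ⟨w, hw, hw0⟩ := ih
      have hp : 0 < ((2 : ℂ) ^ n * τ).im := by rw [him]; positivity
      have e : (2 : ℂ) ^ (n + 1) * τ = 2 * ((2 : ℂ) ^ n * τ) := by ring
      have h := theta_dup w _ hp
      rw [hw0, zero_mul] at h
      refine ⟨2 * w + 1 / 2, ?_, ?_⟩
      · rw [e]
        have : (2 * w + 1 / 2).im = 2 * w.im := by simp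
        rw [this, hw]
        simp
        ring
      · rw [e]
        refine (mul_eq_zero.mp h.symm).resolve_right (theta_half_ne_zero _ ?_)
        simpa using hp
  obtain ⟨n, hn⟩ := exists_large (c := τ.im * (1 - 2 * |t|)) (mul_pos hτ (by linarith))
  obtain ⟨w, hw, hw0⟩ := key n
  refine theta_ne_zero_of_large (t := t) (by rw [him]; positivity) ht hw ?_ hw0
  rw [him]
  convert! hn using 3
  ring

lemma theta_shift_zero (n : ℕ) (z τ : ℂ) :
    jacobiTheta₂ (z + n * τ) τ = 0 ↔ jacobiTheta₂ z τ = 0 := by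
  induction n with
  | zero => simp
  | succ n ih =>
    rw [← ih, show z + ((n + 1 : ℕ) : ℂ) * τ = z + n * τ + τ by push_cast; ring,
      jacobiTheta₂_add_left']
    simp [Complex.exp_ne_zero]

lemma theta_shift_zero_int (n : ℤ) (z τ : ℂ) :
    jacobiTheta₂ (z + n * τ) τ = 0 ↔ jacobiTheta₂ z τ = 0 := by
  obtain ⟨k, rfl | rfl⟩ := n.eq_nat_or_neg
  · exact_mod_cast theta_shift_zero k z τ
  · rw [← theta_shift_zero k (z + _) τ]
    push_cast
    rw [neg_mul, neg_add_cancel_right]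

/-- A zero has imaginary part a half-odd multiple of `Im τ`. -/
lemma theta_zero_im (τ z : ℂ) (hτ : 0 < τ.im) (h0 : jacobiTheta₂ z τ = 0) :
    ∃ n : ℤ, z.im = (n + 1 / 2) * τ.im := by
  set t := z.im / τ.im with htdef
  have ht : z.im = t * τ.im := by rw [htdef]; field_simp
  by_contra hcon
  push Not at hcon
  refine theta_ne_zero_strip τ (z + ((-round t : ℤ) : ℂ) * τ) hτ (t - round t) ?_ ?_
    ((theta_shift_zero_int _ _ _).mpr h0)
  · refine lt_of_le_of_ne (abs_sub_round t) fun h => ?_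
    rcases (abs_eq (by norm_num)).mp h with h | h
    · exact hcon (round t) (by rw [ht]; congr 1; linarith)
    · exact hcon (round t - 1) (by rw [ht]; congr 1; push_cast; linarith)
  · have : (((-round t : ℤ) : ℂ) * τ).im = -round t * τ.im := by
      simp
    rw [Complex.add_im, this, ht]
    ring

lemma theta_zero_lattice (τ z : ℂ) (hτ : 0 < τ.im) (h0 : jacobiTheta₂ z τ = 0) :
    ∃ m n : ℤ, z = (m + 1 / 2) + (n + 1 / 2) * τ := by
  obtain ⟨n, hn⟩ := theta_zero_im τ z hτ h0
  have hτ0 : τ ≠ 0 := by rintro rfl; simp at hτ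
  have him' : 0 < (-1 / τ).im := by
    rw [neg_div, Complex.neg_im, one_div, Complex.inv_im, neg_div, neg_neg]
    exact div_pos hτ (Complex.normSq_pos.mpr hτ0)
  -- z = s + (n + 1/2) τ with s real
  set s : ℝ := (z - (n + 1 / 2) * τ).re with hs
  have hzs : z = s + (n + 1 / 2) * τ := by
    have : z - (n + 1 / 2) * τ = s := by
      apply Complex.ext
      · simp [hs]
      · have e : ((n : ℂ) + 1 / 2) = (((n : ℝ) + 1 / 2 : ℝ) : ℂ) := by push_cast; rfl
        rw [e, Complex.sub_im, Complex.im_ofReal_mul, hn]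
        simp
    linear_combination this
  have hfe := jacobiTheta₂_functional_equation z τ
  rw [h0] at hfe
  have hI : (-I * τ) ≠ 0 := mul_ne_zero (neg_ne_zero.mpr I_ne_zero) hτ0
  have h1 : jacobiTheta₂ (z / τ) (-1 / τ) = 0 := by
    refine (mul_eq_zero.mp hfe.symm).resolve_left (mul_ne_zero (one_div_ne_zero ?_)
      (Complex.exp_ne_zero _))
    rw [Complex.cpow_def_of_ne_zero hI]
    exact Complex.exp_ne_zero _
  obtain ⟨m, hm⟩ := theta_zero_im _ _ him' h1
  have h2 : z / τ = ((-s : ℝ) : ℂ) * (-1 / τ) + (((n : ℝ) + 1 / 2 : ℝ) : ℂ) := by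
    conv_lhs => rw [hzs]
    push_cast
    field_simp
    try ring
  rw [h2, Complex.add_im, Complex.im_ofReal_mul, Complex.ofReal_im, add_zero] at hm
  have h3 := mul_right_cancel₀ him'.ne' hm
  refine ⟨-m - 1, n, ?_⟩
  conv_lhs => rw [hzs]
  have h4 : (s : ℂ) = -(m + 1 / 2) := by
    have : s = -((m : ℝ) + 1 / 2) := by linarith
    rw [this]; push_cast; rfl
  rw [h4]
  push_cast
  ring

lemma theta1_ne_zero (τ z : ℂ) (hτ : 0 < τ.im) (hz : z ∉ latticeZtau τ) :
    jacobiTheta1 z τ ≠ 0 := by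
  intro h
  rw [theta1_eq] at h
  have h' : jacobiTheta₂ (z + τ / 2 + 1 / 2) τ = 0 := by
    simpa [Complex.exp_ne_zero] using h
  obtain ⟨m, n, e⟩ := theta_zero_lattice τ _ hτ h'
  exact hz ⟨m, n, by linear_combination e⟩

lemma wpZero_neg (w τ : ℂ) : wpZero (-w) τ = wpZero w τ := by
  unfold wpZero
  rw [theta4_neg, theta1_neg, neg_mul, div_neg, neg_sq]

/-- **Unitarity:** for `Im τ > 0` and `μ, ξ ∉ ℤ + τℤ`, for every `f : ℂ → ℂ` and every
`z ∉ ℤ + τℤ`, `(R(R̄ f))(z) = (℘⁰(μ|τ) − ℘⁰(ξ|τ)) f(z)`; in particular the constant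
`℘⁰(μ|τ) − ℘⁰(ξ|τ)` vanishes when `ξ = ±μ`. -/
theorem opR_opRbar_unitarity (τ μ ξ : ℂ) (hτ : 0 < τ.im)
    (hμ : μ ∉ latticeZtau τ) (hξ : ξ ∉ latticeZtau τ) :
    (∀ f : ℂ → ℂ, ∀ z : ℂ, z ∉ latticeZtau τ →
      opR μ ξ τ (opRbar μ ξ τ f) z = (wpZero μ τ - wpZero ξ τ) * f z) ∧
    ((ξ = μ ∨ ξ = -μ) → wpZero μ τ - wpZero ξ τ = 0) := by
  refine ⟨fun f z hz => ?_, ?_⟩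
  · have hz0 := theta1_ne_zero τ z hτ hz
    have hμ0 := theta1_ne_zero τ μ hτ hμ
    have hξ0 := theta1_ne_zero τ ξ hτ hξ
    have h40 : jacobiTheta4 0 τ ≠ 0 := by
      rw [theta4_eq, zero_add]; exact theta_half_ne_zero τ hτ
    have A := theta_addition z μ τ hτ
    have B := theta_addition z ξ τ hτ
    simp only [opR, opRbar, sigmaTheta, wpZero, neg_neg]
    rw [show -z - μ = -(z + μ) by ring, show -z - -ξ = -(z - ξ) by ring,
      show z - -ξ = z + ξ by ring]
    simp only [theta1_neg]
    generalize jacobiTheta1 (z + μ) τ = a1 at *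
    generalize jacobiTheta1 (z - μ) τ = a2 at *
    generalize jacobiTheta1 (z + ξ) τ = b1 at *
    generalize jacobiTheta1 (z - ξ) τ = b2 at *
    generalize jacobiTheta1 z τ = c at *
    generalize jacobiTheta1 μ τ = m at *
    generalize jacobiTheta1 ξ τ = x at *
    generalize jacobiTheta4 0 τ = k at *
    generalize jacobiTheta4 z τ = cz at *
    generalize jacobiTheta4 μ τ = mz at *
    generalize jacobiTheta4 ξ τ = xz at *
    generalize jacobiTheta1'zero τ = d at *
    have A' : a2 * a1 = (c ^ 2 * mz ^ 2 - cz ^ 2 * m ^ 2) / k ^ 2 := by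
      rw [← A]; field_simp
    have B' : b2 * b1 = (c ^ 2 * xz ^ 2 - cz ^ 2 * x ^ 2) / k ^ 2 := by
      rw [← B]; field_simp
    trans (a2 * a1 / (c ^ 2 * m ^ 2) - b2 * b1 / (c ^ 2 * x ^ 2)) * d ^ 2 * f z
    · field_simp
      ring
    · rw [A', B']
      field_simp
      ring
  · rintro (rfl | rfl)
    · exact sub_self _
    · rw [wpZero_neg, sub_self]
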